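/- (Feature cloning constraint for the normalized uniformity metric.) Define 𝒰(Z) := − E(MST(Z)) / √(2(d+1)/d) for an n-tuple Z of points in ℝ^d. If z₁, …, zₙ ∈ ℝ^d are not all equal (so that E(MST(Z)) > 0), then 𝒰((z₁⊕z₁, …, zₙ⊕zₙ)) < 𝒰((z₁, …, zₙ)), where z_i ⊕ z_i ∈ ℝ^{2d} is the concatenation of z_i with itself and the left-hand normalization uses dimension 2d. -/

import Mathlib

open scoped BigOperators

/-- The length of an edge `e` (an unordered pair of indices) with respect to
points `z` in Euclidean space: the Euclidean distance between its endpoints. -/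
noncomputable def edgeLen {V : Type*} {d : ℕ} (z : V → EuclideanSpace ℝ (Fin d)) :
    Sym2 V → ℝ :=
  Sym2.lift ⟨fun i j => dist (z i) (z j), fun i j => dist_comm (z i) (z j)⟩

/-- The total edge length of a graph `G` on the (finite) index set `V`,
with respect to points `z` in Euclidean space. -/
noncomputable def treeLength {V : Type*} [Finite V] {d : ℕ}
    (z : V → EuclideanSpace ℝ (Fin d)) (G : SimpleGraph V) : ℝ :=
  ∑ e ∈ (Set.toFinite G.edgeSet).toFinset, edgeLen z e

/-- The minimum spanning tree length of the points `z`: the infimum of the total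
edge lengths of all spanning trees (connected acyclic simple graphs) on `V`. -/
noncomputable def mstLength {V : Type*} [Finite V] {d : ℕ}
    (z : V → EuclideanSpace ℝ (Fin d)) : ℝ :=
  sInf (treeLength z '' {G : SimpleGraph V | G.IsTree})

/-- The concatenation `x ⊕ x ∈ ℝ^(d+d)` of a point `x ∈ ℝ^d` with itself. -/
noncomputable def dupPoint {d : ℕ} (x : EuclideanSpace ℝ (Fin d)) :
    EuclideanSpace ℝ (Fin (d + d)) :=
  (WithLp.equiv 2 (Fin (d + d) → ℝ)).symm
    (Fin.append ((WithLp.equiv 2 (Fin d → ℝ)) x) ((WithLp.equiv 2 (Fin d → ℝ)) x))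

/-- The normalized uniformity metric in ambient dimension `d`:
`𝒰(Z) = − E(MST(Z)) / √(2(d+1)/d)`. -/
noncomputable def uniformityMetric {V : Type*} [Finite V] {d : ℕ}
    (z : V → EuclideanSpace ℝ (Fin d)) : ℝ :=
  -(mstLength z) / Real.sqrt (2 * ((d : ℝ) + 1) / (d : ℝ))

theorem dist_dupPoint {d : ℕ} (x y : EuclideanSpace ℝ (Fin d)) :
    dist (dupPoint x) (dupPoint y) = Real.sqrt 2 * dist x y := by
  rw [EuclideanSpace.dist_eq, EuclideanSpace.dist_eq, ← Real.sqrt_mul zero_le_two,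
    Fin.sum_univ_add]
  simp [dupPoint, two_mul, -Fin.natAdd_eq_addNat]

theorem treeLength_dupPoint {V : Type*} [Finite V] {d : ℕ}
    (z : V → EuclideanSpace ℝ (Fin d)) (G : SimpleGraph V) :
    treeLength (fun i => dupPoint (z i)) G = Real.sqrt 2 * treeLength z G := by
  rw [treeLength, treeLength, Finset.mul_sum]
  refine Finset.sum_congr rfl fun e _ => ?_
  induction e with
  | _ i j => exact dist_dupPoint (z i) (z j)

theorem mstLength_dupPoint {V : Type*} [Finite V] {d : ℕ}
    (z : V → EuclideanSpace ℝ (Fin d)) :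
    mstLength (fun i => dupPoint (z i)) = Real.sqrt 2 * mstLength z := by
  rw [mstLength, mstLength, ← smul_eq_mul, ← Real.sInf_smul_of_nonneg (Real.sqrt_nonneg 2),
    ← Set.image_smul, Set.image_image]
  simp only [treeLength_dupPoint, smul_eq_mul]

theorem edgeLen_nonneg {V : Type*} {d : ℕ} (z : V → EuclideanSpace ℝ (Fin d)) (e : Sym2 V) :
    0 ≤ edgeLen z e := by
  induction e with
  | _ i j => exact dist_nonneg (x := z i) (y := z j)

theorem treeLength_pos {V : Type*} [Finite V] {d : ℕ} {z : V → EuclideanSpace ℝ (Fin d)}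
    (hne : ∃ i j, z i ≠ z j) {G : SimpleGraph V} (hG : G.Connected) :
    0 < treeLength z G := by
  refine (Finset.sum_nonneg fun e _ => edgeLen_nonneg z e).lt_of_ne' fun h => ?_
  have hadj : ∀ i j, G.Adj i j → z i = z j := fun i j hij =>
    dist_eq_zero.1 ((Finset.sum_eq_zero_iff_of_nonneg fun e _ => edgeLen_nonneg z e).1 h s(i, j)
      (by simpa using hij))
  obtain ⟨i, j, hij⟩ := hne
  obtain ⟨p⟩ := hG.preconnected i j
  apply hij
  clear hij
  induction p with
  | nil => rfl
  | cons h _ ih => exact (hadj _ _ h).trans ih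

theorem mstLength_pos {V : Type*} [Finite V] {d : ℕ} {z : V → EuclideanSpace ℝ (Fin d)}
    (hne : ∃ i j, z i ≠ z j) : 0 < mstLength z := by
  have : Nonempty V := ⟨hne.choose⟩
  obtain ⟨T, -, hT⟩ := (SimpleGraph.connected_top (V := V)).exists_isTree_le
  obtain ⟨G, hG, h⟩ := Set.Nonempty.csInf_mem (s := treeLength z '' {G | G.IsTree})
    ⟨_, T, hT, rfl⟩ (Set.toFinite _)
  rw [mstLength, ← h]
  exact treeLength_pos hne hG.connected

/-- Feature cloning constraint: if the points are not all equal, cloning the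
features strictly decreases the normalized uniformity metric. -/
theorem uniformityMetric_feature_cloning_lt {d n : ℕ}
    (z : Fin n → EuclideanSpace ℝ (Fin d))
    (hne : ∃ i j : Fin n, z i ≠ z j) :
    uniformityMetric (fun i => dupPoint (z i)) < uniformityMetric z := by
  have hm := mstLength_pos hne
  have hd : (0 : ℝ) < d := by
    rcases Nat.eq_zero_or_pos d with rfl | h
    · obtain ⟨i, j, hij⟩ := hne
      exact absurd (Subsingleton.elim _ _) hij
    · exact_mod_cast h
  rw [uniformityMetric, uniformityMetric, mstLength_dupPoint, neg_div, neg_div, neg_lt_neg_iff,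
    div_lt_div_iff₀ (by positivity) (by push_cast; positivity), mul_comm (Real.sqrt 2), mul_assoc,
    ← Real.sqrt_mul zero_le_two]
  refine mul_lt_mul_of_pos_left (Real.sqrt_lt_sqrt (by positivity) ?_) hm
  push_cast
  rw [← mul_div_assoc, div_lt_div_iff₀ (by positivity) hd]
  nlinarith
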